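/- arXiv:1812.08148 — 3 statements merged into one kernel-verified Lean document; each statement's English description precedes it below -/
import Mathlib

section
/- Let c > 0 be a real constant. For every real n > 0, the function g(n) = (1 + e^{−c/n}) / ((n+1) − (n−1)·e^{−c/n}) is differentiable at n with derivative g'(n) = (2·(c/n)·e^{−c/n} + e^{−2c/n} − 1) / ((n+1) − (n−1)·e^{−c/n})². (Here the denominator (n+1) − (n−1)e^{−c/n} is strictly positive for all n > 0.) -/
/-- For `c > 0` and `n > 0`, the denominator `(n+1) − (n−1)e^{−c/n}` is strictly positive and
`g(n) = (1 + e^{−c/n}) / ((n+1) − (n−1)e^{−c/n})` is differentiable at `n` with derivative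
`(2(c/n)e^{−c/n} + e^{−2c/n} − 1) / ((n+1) − (n−1)e^{−c/n})²`. -/
theorem stmt_1 (c : ℝ) (hc : 0 < c) (n : ℝ) (hn : 0 < n) :
    0 < (n + 1) - (n - 1) * Real.exp (-(c / n)) ∧
    HasDerivAt (fun m : ℝ => (1 + Real.exp (-(c / m))) / ((m + 1) - (m - 1) * Real.exp (-(c / m))))
      ((2 * (c / n) * Real.exp (-(c / n)) + Real.exp (-(2 * c / n)) - 1) /
        ((n + 1) - (n - 1) * Real.exp (-(c / n))) ^ 2) n := by
  have hE : Real.exp (-(c / n)) < 1 :=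
    Real.exp_zero ▸ Real.exp_lt_exp.mpr (neg_lt_zero.mpr (div_pos hc hn))
  have hsq : Real.exp (-(2 * c / n)) = Real.exp (-(c / n)) ^ 2 := by
    rw [← Real.exp_nat_mul]
    congr 1
    push_cast
    ring
  have hpos : 0 < (n + 1) - (n - 1) * Real.exp (-(c / n)) := by
    nlinarith [mul_pos hn (sub_pos.mpr hE), Real.exp_pos (-(c / n))]
  refine ⟨hpos, ?_⟩
  have hexp : HasDerivAt (fun m : ℝ => Real.exp (-(c / m)))
      (Real.exp (-(c / n)) * (c / n ^ 2)) n := by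
    have h : HasDerivAt (fun m : ℝ => -(c / m)) (c / n ^ 2) n := by
      simpa [div_eq_mul_inv] using ((hasDerivAt_inv hn.ne').const_mul c).fun_neg
    exact h.exp
  have hden : HasDerivAt (fun m : ℝ => (m + 1) - (m - 1) * Real.exp (-(c / m)))
      (1 - (1 * Real.exp (-(c / n)) + (n - 1) * (Real.exp (-(c / n)) * (c / n ^ 2)))) n :=
    ((hasDerivAt_id n).add_const 1).sub (((hasDerivAt_id n).sub_const 1).mul hexp)
  refine ((hexp.const_add 1).fun_div hden hpos.ne').congr_deriv ?_
  rw [hsq]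
  congr 1
  field_simp
  ring
end

section
/- Let c > 0 be a real constant. The function g(n) = (1 + e^{−c/n}) / ((n+1) − (n−1)·e^{−c/n}) is antitone (non-increasing) on the interval (0, ∞). Consequently, for any constants C ≥ 0 and K, the function n ↦ C·g(n) + K is antitone on (0, ∞). -/
open Real in
theorem two_mul_self_mul_exp_neg_le {x : ℝ} (hx : 0 ≤ x) :
    2 * x * exp (-x) ≤ 1 - exp (-x) ^ 2 := by
  have h := self_le_sinh_iff.2 hx
  rw [sinh_eq] at h
  have hmul : exp x * exp (-x) = 1 := by rw [← exp_add]; simp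
  nlinarith [exp_pos (-x)]

open Real in
theorem monotoneOn_mul_one_sub_exp_div_one_add_exp {c : ℝ} (hc : 0 ≤ c) :
    MonotoneOn (fun n : ℝ => n * (1 - exp (-(c / n))) / (1 + exp (-(c / n)))) (Set.Ioi 0) := by
  have hderiv : ∀ n ∈ Set.Ioi (0 : ℝ),
      HasDerivAt (fun n : ℝ => n * (1 - exp (-(c / n))) / (1 + exp (-(c / n))))
        ((1 - exp (-(c / n)) ^ 2 - 2 * (c / n) * exp (-(c / n))) / (1 + exp (-(c / n))) ^ 2) n := by
    intro n hn
    have hn0 : n ≠ 0 := (Set.mem_Ioi.1 hn).ne'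
    have hpos : 1 + exp (-(c / n)) ≠ 0 := by positivity
    have hq : HasDerivAt (fun n : ℝ => exp (-(c / n))) (exp (-(c / n)) * (c / n ^ 2)) n := by
      refine (((hasDerivAt_const n c).fun_div (hasDerivAt_id' n) hn0).fun_neg.exp).congr_deriv ?_
      ring
    refine (((hasDerivAt_id' n).fun_mul (hq.const_sub 1)).fun_div (hq.const_add 1) hpos).congr_deriv ?_
    field_simp
    ring
  refine monotoneOn_of_hasDerivWithinAt_nonneg (convex_Ioi 0)
    (fun n hn => (hderiv n hn).continuousAt.continuousWithinAt)
    (fun n hn => (hderiv n (interior_subset hn)).hasDerivWithinAt) fun n hn => ?_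
  have hn0 : 0 < n := interior_subset hn
  have := two_mul_self_mul_exp_neg_le (x := c / n) (by positivity)
  exact div_nonneg (by linarith) (by positivity)

/-- For `c > 0`, the function `g(n) = (1 + e^{−c/n}) / ((n+1) − (n−1)e^{−c/n})` is antitone on
`(0, ∞)`, and consequently so is `n ↦ C·g(n) + K` for any `C ≥ 0` and any `K`. -/
theorem stmt_2 (c : ℝ) (hc : 0 < c) :
    AntitoneOn (fun n : ℝ => (1 + Real.exp (-(c / n))) / ((n + 1) - (n - 1) * Real.exp (-(c / n))))
      (Set.Ioi 0) ∧
    ∀ C K : ℝ, 0 ≤ C →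
      AntitoneOn (fun n : ℝ =>
        C * ((1 + Real.exp (-(c / n))) / ((n + 1) - (n - 1) * Real.exp (-(c / n)))) + K)
        (Set.Ioi 0) := by
  have anti : AntitoneOn
      (fun n : ℝ => (1 + Real.exp (-(c / n))) / ((n + 1) - (n - 1) * Real.exp (-(c / n))))
      (Set.Ioi 0) := by
    have key : ∀ n ∈ Set.Ioi (0 : ℝ),
        (1 + Real.exp (-(c / n))) / ((n + 1) - (n - 1) * Real.exp (-(c / n))) =
          1 / (1 + n * (1 - Real.exp (-(c / n))) / (1 + Real.exp (-(c / n)))) := by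
      intro n _
      have hpos : 1 + Real.exp (-(c / n)) ≠ 0 := by positivity
      rw [one_add_div hpos, one_div_div]
      congr 1
      ring
    intro a ha b hb hab
    have ha0 : 0 < a := ha
    have hle : Real.exp (-(c / a)) ≤ 1 := Real.exp_le_one_iff.2 (by
      have : 0 ≤ c / a := by positivity
      linarith)
    have hnonneg : 0 ≤ a * (1 - Real.exp (-(c / a))) / (1 + Real.exp (-(c / a))) :=
      div_nonneg (mul_nonneg ha0.le (by linarith)) (by positivity)
    have hmono := monotoneOn_mul_one_sub_exp_div_one_add_exp hc.le ha hb hab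
    simp only at hmono ⊢
    rw [key a ha, key b hb]
    exact one_div_le_one_div_of_le (by linarith) (by linarith)
  refine ⟨anti, fun C K hC a ha b hb hab => ?_⟩
  have := mul_le_mul_of_nonneg_left (anti ha hb hab) hC
  simp only at this ⊢
  linarith
end

section
/- Let N ≥ 1 be a natural number, α > 0, T_c > 0 and T real numbers. Set e = e^{−αT_c/N}, D = (N+1) − (N−1)·e, x = (T − T_c − 1/α)/D, y = x·e, and x_{N+1} = x + y + 1/α. Then N·(x²/2 − y²/2 + (x − y)/α) + x_{N+1}²/2 = (1/2)·(T − T_c − 1/α)² · (1 + e)/D + (T − T_c)/α − 1/(2α²). -/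
/-- Closed-form minimal age identity for the exponentially decaying age model: with
`e = e^{−αT_c/N}`, `D = (N+1) − (N−1)e`, `x = (T − T_c − 1/α)/D`, `y = x·e`,
`x_{N+1} = x + y + 1/α`, we have
`N(x²/2 − y²/2 + (x − y)/α) + x_{N+1}²/2
  = (1/2)(T − T_c − 1/α)²(1 + e)/D + (T − T_c)/α − 1/(2α²)`. -/
theorem stmt_5 (N : ℕ) (hN : 1 ≤ N) (α Tc T : ℝ) (hα : 0 < α) (hTc : 0 < Tc)
    (e D x y xN1 : ℝ)
    (he : e = Real.exp (-(α * Tc / N)))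
    (hD : D = ((N : ℝ) + 1) - ((N : ℝ) - 1) * e)
    (hx : x = (T - Tc - 1 / α) / D)
    (hy : y = x * e)
    (hxN1 : xN1 = x + y + 1 / α) :
    (N : ℝ) * (x ^ 2 / 2 - y ^ 2 / 2 + (x - y) / α) + xN1 ^ 2 / 2 =
      (1 / 2) * (T - Tc - 1 / α) ^ 2 * ((1 + e) / D) + (T - Tc) / α - 1 / (2 * α ^ 2) := by
  have hN' : (1 : ℝ) ≤ N := by exact_mod_cast hN
  have he1 : e ≤ 1 := by
    rw [he, Real.exp_le_one_iff, neg_nonpos]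
    positivity
  have hD0 : D ≠ 0 := by
    have : 0 < D := by
      rw [hD]
      nlinarith [mul_nonneg (sub_nonneg.2 hN') (sub_nonneg.2 he1)]
    exact this.ne'
  have hα0 : α ≠ 0 := hα.ne'
  have hS : T - Tc - 1 / α = x * D := by rw [hx, div_mul_cancel₀ _ hD0]
  have hT : T - Tc = x * D + 1 / α := by linarith
  have hsq : (1 / 2) * (x * D) ^ 2 * ((1 + e) / D) = (1 / 2) * x ^ 2 * D * (1 + e) := by
    field_simp
  rw [hS, hT, hsq, hxN1, hy, hD]
  field_simp
  ring
end
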